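/- Let P be a level-block matrix with nonnegative r×r blocks that is skip-free downward and level-homogeneous above level 0, i.e., P_{a,b} = A_{b−a} for all levels a ≥ 1 and b ≥ 0, where A_k (k ≥ −1) are nonnegative r×r matrices and A_k := 0 for k < −1. If i, j, i', j' ≥ 1 satisfy j < i, j' < i', and i − j = i' − j', then the first-entrance taboo matrices agree entrywise: L̂^{P}_{i→j} = L̂^{P}_{i'→j'}. -/

import Mathlib

open scoped BigOperators ENNReal

/-- The first-entrance taboo matrix `L̂^P_{i→j}`: the `(α,β)` entry is the sum, over all
paths `ℓ_0 = i, ℓ_1, …, ℓ_k = j` (`k ≥ 1`) with `ℓ_t ∉ {i, j}` for `1 ≤ t ≤ k-1`, of the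
`(α,β)` entry of the product `P_{ℓ_0,ℓ_1} ⋯ P_{ℓ_{k-1},ℓ_k}`, taken in `[0,∞]`. -/
noncomputable def tabooFE (r : ℕ) (P : ℕ → ℕ → Matrix (Fin r) (Fin r) ℝ)
    (i j : ℕ) (α β : Fin r) : ℝ≥0∞ :=
  ∑' k : ℕ,
    ∑' ℓ : {f : Fin (k + 2) → ℕ //
        f 0 = i ∧ f (Fin.last (k + 1)) = j ∧
          ∀ t : Fin (k + 2), 1 ≤ (t : ℕ) → (t : ℕ) ≤ k → f t ≠ i ∧ f t ≠ j},
      ENNReal.ofReal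
        (((List.ofFn fun t : Fin (k + 1) => P (ℓ.1 t.castSucc) (ℓ.1 t.succ)).prod) α β)

/-- The increment-form counterpart of `tabooFE`, with levels measured from the target level. -/
noncomputable def homogeneousTaboo (r : ℕ) (A : ℤ → Matrix (Fin r) (Fin r) ℝ)
    (n : ℕ) (α β : Fin r) : ℝ≥0∞ :=
  ∑' k : ℕ,
    ∑' d : {d : Fin (k + 2) → ℕ //
        d 0 = n ∧ d (Fin.last (k + 1)) = 0 ∧
          ∀ t : Fin (k + 2), 1 ≤ (t : ℕ) → (t : ℕ) ≤ k → d t ≠ n ∧ d t ≠ 0},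
      ENNReal.ofReal
        (((List.ofFn fun t : Fin (k + 1) =>
          A ((d.1 t.succ : ℤ) - (d.1 t.castSucc : ℤ))).prod) α β)

/-- A path with downward steps of size at most one that starts above `j` and avoids `j` before its
last step never goes below `j`. -/
lemma le_of_skipFree_path {k i j : ℕ} {f : Fin (k + 2) → ℕ} (hji : j < i) (h0 : f 0 = i)
    (hlast : f (Fin.last (k + 1)) = j)
    (havoid : ∀ t : Fin (k + 2), 1 ≤ (t : ℕ) → (t : ℕ) ≤ k → f t ≠ j)
    (hstep : ∀ t : Fin (k + 1), f t.castSucc ≤ f t.succ + 1) (t : Fin (k + 2)) : j ≤ f t := by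
  have above : ∀ m (hm : m ≤ k), j < f ⟨m, by omega⟩ := by
    intro m
    induction m with
    | zero => intro _; exact hji.trans_eq h0.symm
    | succ m ih =>
      intro hm
      have h1 := ih (by omega)
      have h2 : f ⟨m, by omega⟩ ≤ f ⟨m + 1, by omega⟩ + 1 := hstep ⟨m, by omega⟩
      have h3 := havoid ⟨m + 1, by omega⟩ (Nat.le_add_left 1 m) hm
      omega
  rcases Nat.lt_or_ge k t with ht | ht
  · have : t = Fin.last (k + 1) := Fin.ext (by simp; omega)
    rw [this, hlast]
  · exact (above t ht).le

lemma tabooFE_eq_homogeneousTaboo {r : ℕ} {A : ℤ → Matrix (Fin r) (Fin r) ℝ}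
    {P : ℕ → ℕ → Matrix (Fin r) (Fin r) ℝ}
    (hPsf : ∀ a b, b + 1 < a → P a b = 0)
    (hhom : ∀ a b : ℕ, 1 ≤ a → P a b = A ((b : ℤ) - (a : ℤ)))
    {i j : ℕ} (hj : 1 ≤ j) (hji : j < i) (α β : Fin r) :
    tabooFE r P i j α β = homogeneousTaboo r A (i - j) α β := by
  unfold tabooFE homogeneousTaboo
  refine tsum_congr fun k => ?_
  let g : {d : Fin (k + 2) → ℕ //
        d 0 = i - j ∧ d (Fin.last (k + 1)) = 0 ∧
          ∀ t : Fin (k + 2), 1 ≤ (t : ℕ) → (t : ℕ) ≤ k → d t ≠ i - j ∧ d t ≠ 0} →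
      {f : Fin (k + 2) → ℕ //
        f 0 = i ∧ f (Fin.last (k + 1)) = j ∧
          ∀ t : Fin (k + 2), 1 ≤ (t : ℕ) → (t : ℕ) ≤ k → f t ≠ i ∧ f t ≠ j} :=
    fun d => ⟨fun t => d.1 t + j, by have := d.2.1; dsimp only; omega,
      by have := d.2.2.1; dsimp only; omega,
      fun t h1 h2 => by have := d.2.2.2 t h1 h2; dsimp only; omega⟩
  have hg : Function.Injective g := fun d e h => Subtype.ext <| funext fun t =>
    Nat.add_right_cancel (congrFun (congrArg Subtype.val h) t)
  rw [← hg.tsum_eq]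
  · refine tsum_congr fun d => ?_
    refine congrArg (fun M : Fin (k + 1) → Matrix (Fin r) (Fin r) ℝ =>
      ENNReal.ofReal ((List.ofFn M).prod α β)) (funext fun t => ?_)
    change P (d.1 t.castSucc + j) (d.1 t.succ + j) = _
    rw [hhom _ _ (by omega)]
    congr 1
    push_cast
    ring
  · intro f hf
    have hstep : ∀ t : Fin (k + 1), f.1 t.castSucc ≤ f.1 t.succ + 1 := by
      intro t
      by_contra! h
      refine hf ?_
      have hzero : (List.ofFn fun t : Fin (k + 1) => P (f.1 t.castSucc) (f.1 t.succ)).prod = 0 :=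
        List.prod_eq_zero (List.mem_ofFn.2 ⟨t, hPsf _ _ h⟩)
      dsimp only
      rw [hzero, Matrix.zero_apply, ENNReal.ofReal_zero]
    have hle := le_of_skipFree_path hji f.2.1 f.2.2.1 (fun t h1 h2 => (f.2.2.2 t h1 h2).2) hstep
    refine ⟨⟨fun t => f.1 t - j, by dsimp only; rw [f.2.1],
      by dsimp only; rw [f.2.2.1, Nat.sub_self],
      fun t h1 h2 => ?_⟩, Subtype.ext <| funext fun t => Nat.sub_add_cancel (hle t)⟩
    have := f.2.2.2 t h1 h2
    have := hle t
    dsimp only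
    omega

theorem stmt16 (r : ℕ) (hr : 1 ≤ r)
    (A : ℤ → Matrix (Fin r) (Fin r) ℝ)
    (hAnn : ∀ k α β, 0 ≤ A k α β)
    (hAz : ∀ k : ℤ, k < -1 → A k = 0)
    (P : ℕ → ℕ → Matrix (Fin r) (Fin r) ℝ)
    (hPnn : ∀ a b α β, 0 ≤ P a b α β)
    (hPsf : ∀ a b, b + 1 < a → P a b = 0)
    (hhom : ∀ a b : ℕ, 1 ≤ a → P a b = A ((b : ℤ) - (a : ℤ))) :
    ∀ i j i' j' : ℕ, 1 ≤ i → 1 ≤ j → 1 ≤ i' → 1 ≤ j' →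
      j < i → j' < i' → i - j = i' - j' →
      ∀ α β, tabooFE r P i j α β = tabooFE r P i' j' α β := by
  intro i j i' j' _ hj _ hj' hji hji' hsub α β
  rw [tabooFE_eq_homogeneousTaboo hPsf hhom hj hji,
    tabooFE_eq_homogeneousTaboo hPsf hhom hj' hji', hsub]
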